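/- Let U and W be ultrafilters on sets X and Y such that U ⋉ W = U ⋊ W. Then for every infinite cardinal λ, either U or W is (λ, λ⁺)-indecomposable. -/

import Mathlib

open Filter Set Cardinal

universe u v w

/-- The left tensor product `F ⋉ G` of two filters. -/
def ltimes {X : Type u} {Y : Type v} (F : Filter X) (G : Filter Y) :
    Filter (X × Y) where
  sets := {R | {x | {y | (x, y) ∈ R} ∈ G} ∈ F}
  univ_sets := by simp
  sets_of_superset := by
    intro R S hR hRS
    refine Filter.mem_of_superset hR ?_
    intro x hx
    exact Filter.mem_of_superset hx fun y hy => hRS hy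
  inter_sets := by
    intro R S hR hS
    refine Filter.mem_of_superset (Filter.inter_mem hR hS) ?_
    rintro x ⟨hx1, hx2⟩
    exact Filter.inter_mem hx1 hx2

/-- The right tensor product `F ⋊ G` of two filters. -/
def rtimes {X : Type u} {Y : Type v} (F : Filter X) (G : Filter Y) :
    Filter (X × Y) where
  sets := {R | {y | {x | (x, y) ∈ R} ∈ F} ∈ G}
  univ_sets := by simp
  sets_of_superset := by
    intro R S hR hRS
    refine Filter.mem_of_superset hR ?_
    intro y hy
    exact Filter.mem_of_superset hy fun x hx => hRS hx
  inter_sets := by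
    intro R S hR hS
    refine Filter.mem_of_superset (Filter.inter_mem hR hS) ?_
    rintro y ⟨hy1, hy2⟩
    exact Filter.inter_mem hy1 hy2

/-- `IsFClosed F G` means: `G` is `F`-closed. -/
def IsFClosed {X : Type u} {Y : Type v} (F : Filter X) (G : Filter Y) : Prop :=
  ∀ B : X → Set Y, (∀ x, B x ∈ G) → ∃ A ∈ F, (⋂ x ∈ A, B x) ∈ G

/-- `IsRegularFor F G` means: `F` is `G`-regular. -/
def IsRegularFor {X : Type u} {Y : Type v} (F : Filter X) (G : Filter Y) : Prop :=
  ∃ A : Y → Set X, (∀ y, A y ∈ F) ∧ ∀ B : Set Y, Bᶜ ∉ G → (⋂ y ∈ B, A y) = ∅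

/-- The Katetov order on filters: `G ≤kat H` iff some pushforward of `H` extends `G`. -/
def Katetov {Y : Type u} {Z : Type v} (G : Filter Y) (H : Filter Z) : Prop :=
  ∃ f : Z → Y, Filter.map f H ≤ G

/-- A filter is an ultrafilter. -/
def IsUltra {α : Type u} (F : Filter α) : Prop :=
  ∃ V : Ultrafilter α, (V : Filter α) = F

/-- `(λ, η)`-indecomposability of a filter. -/
def Indecomposable {X : Type u} (F : Filter X) (lam eta : Cardinal.{u}) : Prop :=
  ∀ P : Set (Set X), #P ≤ eta → ⋃₀ P ∈ F →
    ∃ Q ⊆ P, #Q < lam ∧ ⋃₀ Q ∈ F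

/-- `λ`-decomposability: the negation of `(λ, λ)`-indecomposability. -/
def Decomposable {X : Type u} (F : Filter X) (lam : Cardinal.{u}) : Prop :=
  ¬ Indecomposable F lam lam

/-- `(κ, δ)`-regularity of a filter. -/
def CardRegular {X : Type u} (F : Filter X) (kappa delta : Cardinal.{u}) : Prop :=
  ∃ B : delta.out → Set X, (∀ α, B α ∈ F) ∧
    ∀ σ : Set delta.out, kappa ≤ #σ → (⋂ α ∈ σ, B α) = ∅

/-- The Fréchet filter `F_λ(λ)`: subsets of (a set of size) `λ` whose complement
has cardinality less than `λ`. -/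
def frechetFilter (lam : Cardinal.{u}) (h : ℵ₀ ≤ lam) : Filter lam.out where
  sets := {A | #(Aᶜ : Set lam.out) < lam}
  univ_sets := by
    have : #((Set.univ : Set lam.out)ᶜ : Set lam.out) = 0 := by simp
    simp only [Set.mem_setOf_eq, this]
    exact lt_of_lt_of_le aleph0_pos h
  sets_of_superset := by
    intro A B hA hAB
    exact lt_of_le_of_lt (Cardinal.mk_le_mk_of_subset (Set.compl_subset_compl.mpr hAB)) hA
  inter_sets := by
    intro A B hA hB
    simp only [Set.mem_setOf_eq, Set.compl_inter]
    exact lt_of_le_of_lt (Cardinal.mk_union_le _ _) (Cardinal.add_lt_of_lt h hA hB)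

/-- The dual of a filter `F` on `X`: the family of complements of members of `F`. -/
def dualFamily {X : Type u} (F : Filter X) : Set (Set X) := {s | sᶜ ∈ F}

/-- The fine filter `𝔽(F)` on the dual of `F`, generated by the sets
`{σ ∈ F* | x ∈ σ}` for `x ∈ X`. -/
def fineFilter {X : Type u} (F : Filter X) : Filter (dualFamily F) :=
  Filter.generate (Set.range fun x : X => {σ : dualFamily F | x ∈ σ.1})

/-- The two iterated quantifiers along `F` and `G` agree for every relation. -/
def EventuallyComm {X Y : Type*} (F : Filter X) (G : Filter Y) : Prop :=
  ∀ R : X → Y → Prop, (∀ᶠ x in F, ∀ᶠ y in G, R x y) ↔ ∀ᶠ y in G, ∀ᶠ x in F, R x y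

theorem EventuallyComm.symm {X Y : Type*} {F : Filter X} {G : Filter Y}
    (h : EventuallyComm F G) : EventuallyComm G F :=
  fun R => (h fun x y => R y x).symm

theorem eventuallyComm_of_ltimes_eq_rtimes {X : Type u} {Y : Type v} {F : Filter X}
    {G : Filter Y} (h : ltimes F G = rtimes F G) : EventuallyComm F G := fun R =>
  Iff.of_eq (congrArg (fun H : Filter (X × Y) => {p : X × Y | R p.1 p.2} ∈ H) h)

/-- No set of fewer than `#A` values of `f` has its preimage in `F`. -/
def IsUniformMap {X : Type v} {A : Type u} (F : Filter X) (f : X → A) : Prop :=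
  ∀ T : Set A, #T < #A → ¬ ∀ᶠ x in F, f x ∈ T

theorem exists_isUniformMap_of_minimal_cover {X A : Type u} {F : Filter X} {P : Set (Set X)}
    (hP : ⋃₀ P ∈ F) (hmin : ∀ Q ⊆ P, #Q < #P → ⋃₀ Q ∉ F) (hA : #A = #P) (h0 : #A ≠ 0) :
    ∃ f : X → A, IsUniformMap F f := by
  classical
  obtain ⟨e⟩ := Cardinal.eq.1 hA
  have : Nonempty A := Cardinal.mk_ne_zero_iff.1 h0
  have hf : ∀ x, ∃ a : A, x ∈ ⋃₀ P → x ∈ (e a).1 := by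
    intro x
    by_cases hx : x ∈ ⋃₀ P
    · obtain ⟨s, hs, hxs⟩ := hx
      exact ⟨e.symm ⟨s, hs⟩, fun _ => by simpa using hxs⟩
    · exact ⟨Classical.arbitrary A, fun h => absurd h hx⟩
  choose f hf using hf
  refine ⟨f, fun T hT hTF => ?_⟩
  refine hmin ((fun a => (e a).1) '' T) ?_ ?_ ?_
  · rintro _ ⟨a, -, rfl⟩
    exact (e a).2
  · exact (mk_image_le.trans_lt hT).trans_eq hA
  · filter_upwards [hP, hTF] with x hx hxT
    exact ⟨_, ⟨f x, hxT, rfl⟩, hf x hx⟩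

theorem exists_isUniformMap_of_not_indecomposable {X : Type u} {F : Filter X}
    {lam : Cardinal.{u}} (hlam : ℵ₀ ≤ lam) (h : ¬ Indecomposable F lam (Order.succ lam)) :
    (∃ f : X → lam.ord.ToType, IsUniformMap F f) ∨
      ∃ f : X → (Order.succ lam).ord.ToType, IsUniformMap F f := by
  unfold Indecomposable at h
  push Not at h
  obtain ⟨P, hPc, hP, hmin⟩ := h
  have hpos : lam ≠ 0 := (aleph0_pos.trans_le hlam).ne'
  by_cases hQ : ∃ Q ⊆ P, #Q ≤ lam ∧ ⋃₀ Q ∈ F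
  · obtain ⟨Q, hQP, hQc, hQF⟩ := hQ
    have hcard : #Q = lam := hQc.antisymm (not_lt.1 fun hlt => hmin Q hQP hlt hQF)
    exact .inl (exists_isUniformMap_of_minimal_cover hQF
      (fun Q' hQ' hlt => hmin Q' (hQ'.trans hQP) (hlt.trans_eq hcard))
      (by simp [hcard]) (by simpa using hpos))
  · push Not at hQ
    have hcard : #P = Order.succ lam :=
      hPc.antisymm (Order.succ_le_of_lt (not_le.1 fun hle => hQ P subset_rfl hle hP))
    exact .inr (exists_isUniformMap_of_minimal_cover hP
      (fun Q' hQ' hlt => hQ Q' hQ' (Order.lt_succ_iff.1 (hlt.trans_eq hcard)))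
      (by simp [hcard]) (by simp))

theorem mk_Iio_ord_toType_lt {c : Cardinal.{u}} (a : c.ord.ToType) : #(Iio a) < c := by
  simpa using mk_Iio_lt a (by simp)

theorem mk_Iic_ord_toType_lt {c : Cardinal.{u}} (hc : ℵ₀ ≤ c) (a : c.ord.ToType) :
    #(Iic a) < c := by
  simpa using mk_Iic_lt a (by simp) (by simpa using hc)

theorem EventuallyComm.eventually_le {X : Type v} {Y : Type w} {U : Ultrafilter X}
    {W : Ultrafilter Y} (h : EventuallyComm (U : Filter X) (W : Filter Y)) {c : Cardinal.{u}}
    {f : X → c.ord.ToType} (hf : IsUniformMap (U : Filter X) f) (g : Y → c.ord.ToType) :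
    ∃ a, ∀ᶠ y in (W : Filter Y), g y ≤ a := by
  by_contra! hg
  have hlt : ∀ x, ∀ᶠ y in (W : Filter Y), f x < g y := fun x => by
    simpa [← Ultrafilter.eventually_not] using hg (f x)
  obtain ⟨y, hy⟩ := ((h _).1 (Eventually.of_forall hlt)).exists
  exact hf (Iio (g y)) (by simpa using mk_Iio_ord_toType_lt (g y)) hy

theorem EventuallyComm.not_isUniformMap {X : Type v} {Y : Type w} {U : Ultrafilter X}
    {W : Ultrafilter Y} (h : EventuallyComm (U : Filter X) (W : Filter Y)) {c : Cardinal.{u}}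
    (hc : ℵ₀ ≤ c) {f : X → c.ord.ToType} (hf : IsUniformMap (U : Filter X) f)
    (g : Y → c.ord.ToType) : ¬ IsUniformMap (W : Filter Y) g := fun hg => by
  obtain ⟨a, ha⟩ := h.eventually_le hf g
  exact hg (Iic a) (by simpa using mk_Iic_ord_toType_lt hc a) ha

theorem exists_injOn_Iio_ord_succ {c : Cardinal.{u}} (hc : ℵ₀ ≤ c)
    (b : (Order.succ c).ord.ToType) :
    ∃ e : (Order.succ c).ord.ToType → c.ord.ToType, InjOn e (Iio b) := by
  have : Nonempty c.ord.ToType :=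
    Cardinal.mk_ne_zero_iff.1 (by simpa using (aleph0_pos.trans_le hc).ne')
  have hle : #(Iio b) ≤ #c.ord.ToType := by
    simpa using Order.lt_succ_iff.1 (mk_Iio_ord_toType_lt b)
  obtain ⟨e⟩ := hle
  refine ⟨Function.extend Subtype.val e fun _ => Classical.arbitrary _, ?_⟩
  rw [injOn_iff_injective]
  convert e.injective using 1
  ext x
  exact Subtype.val_injective.extend_apply _ _ x

/-- The injections of the proper initial segments of `c⁺` into `c` give, as in an Ulam matrix,
`c` many members of `W` such that every point is in fewer than `c` of them. -/
theorem EventuallyComm.not_isUniformMap_succ {X : Type v} {Y : Type w} {U : Ultrafilter X}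
    {W : Ultrafilter Y} (h : EventuallyComm (U : Filter X) (W : Filter Y)) {c : Cardinal.{u}}
    (hc : ℵ₀ ≤ c) {f : X → c.ord.ToType} (hf : IsUniformMap (U : Filter X) f)
    (g : Y → (Order.succ c).ord.ToType) : ¬ IsUniformMap (W : Filter Y) g := fun hg => by
  have hsucc : ℵ₀ ≤ Order.succ c := hc.trans (Order.le_succ c)
  choose e he using exists_injOn_Iio_ord_succ hc
  choose d hd using fun ξ => h.eventually_le hf fun y => e (g y) ξ
  obtain ⟨a, ha⟩ := infinite_pigeonhole_card d (Order.succ c) (by simp) hsucc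
    (by simp [(isRegular_succ hc).cof_ord])
  have hle : #c.ord.ToType ≤ #(d ⁻¹' {a}) := by simpa using (Order.le_succ c).trans ha
  obtain ⟨i⟩ := hle
  have hmem : ∀ x, ∀ᶠ y in (W : Filter Y),
      (i (f x)).1 < g y ∧ e (g y) (i (f x)).1 ≤ a := fun x => by
    have hlt : ∀ᶠ y in (W : Filter Y), (i (f x)).1 < g y := by
      have := hg (Iic (i (f x)).1) (by simpa using mk_Iic_ord_toType_lt hsucc _)
      simpa [← Ultrafilter.eventually_not] using this
    have hda := hd (i (f x)).1
    rw [(i (f x)).2] at hda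
    exact hlt.and hda
  obtain ⟨y, hy⟩ := ((h _).1 (Eventually.of_forall hmem)).exists
  refine hf {α | (i α).1 < g y ∧ e (g y) (i α).1 ≤ a} ?_ hy
  have hinj : Function.Injective fun α : {α | (i α).1 < g y ∧ e (g y) (i α).1 ≤ a} =>
      (⟨e (g y) (i α.1).1, α.2.2⟩ : Iic a) := fun α β hαβ =>
    Subtype.ext <| i.injective <| Subtype.ext <|
      he (g y) α.2.1 β.2.1 (Subtype.ext_iff.1 hαβ)
  simpa using (mk_le_of_injective hinj).trans_lt (mk_Iic_ord_toType_lt hc a)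

theorem indecomposable_of_tensor_comm {X Y : Type u}
    (U : Ultrafilter X) (W : Ultrafilter Y)
    (h : ltimes (U : Filter X) (W : Filter Y) = rtimes (U : Filter X) (W : Filter Y)) :
    ∀ lam : Cardinal.{u}, ℵ₀ ≤ lam →
      Indecomposable (U : Filter X) lam (Order.succ lam) ∨
        Indecomposable (W : Filter Y) lam (Order.succ lam) := by
  intro lam hlam
  have hc := eventuallyComm_of_ltimes_eq_rtimes h
  by_contra! hdec
  obtain ⟨hU, hW⟩ := hdec
  rcases exists_isUniformMap_of_not_indecomposable hlam hU with ⟨f, hf⟩ | ⟨f, hf⟩ <;>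
    rcases exists_isUniformMap_of_not_indecomposable hlam hW with ⟨g, hg⟩ | ⟨g, hg⟩
  · exact hc.not_isUniformMap hlam hf g hg
  · exact hc.not_isUniformMap_succ hlam hf g hg
  · exact hc.symm.not_isUniformMap_succ hlam hg f hf
  · exact hc.not_isUniformMap (hlam.trans (Order.le_succ lam)) hf g hg
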